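/- arXiv:2408.00643 — 3 statements merged into one kernel-verified Lean document; each statement's English description precedes it below -/
import Mathlib

section
/- Let Λ^{τ,φ} = {u ∈ Λ : τ(u) = u and φ(u) = u}. Then the co-invariant lattice {u ∈ Λ : ⟨u,w⟩ = 0 for all w ∈ Λ^{τ,φ}} equals the ℤ-submodule Ω of V generated by the fifteen vectors z, w, f_1-e_1, f_2-e_2, h_1-g_1, h_2-g_2, b_1-a_1, a_1-c_1, c_1-d_1, a_2-b_2, c_2-a_2, d_2-c_2, (a_1-b_1-c_1+d_1-a_2+b_2+c_2-d_2+z-w)/3, (-a_1+d_1+a_2-d_2-e_1+f_1+e_2-f_2-g_1+h_1+g_2-h_2)/3, (a_1+b_1-c_1-d_1-a_2-b_2+c_2+d_2-e_1+f_1+e_2-f_2)/3. -/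
/- Context: V = ℚ^22 with the Gram matrix of the paper, W = ℤ^22,
τ and φ the involutions of the symplectic (ℤ/2ℤ)²-action,
and Λ ≃ Λ_K3 the overlattice of W generated by the standard basis together
with the seven vectors α,β,γ,δ,ε,ζ,η. -/

noncomputable section
open Matrix

abbrev V : Type := Fin 22 → ℚ

def gramX : Matrix (Fin 22) (Fin 22) ℚ := Matrix.of fun i j =>
  if i = j then
    (if i.val < 16 then -2 else if i.val < 18 then -4 else if i.val < 20 then 0 else 4)
  else if i.val / 2 = j.val / 2 then
    (if i.val < 16 then 1 else if i.val < 18 then 2 else if i.val < 20 then 3 else 2)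
  else 0

def B (u v : V) : ℚ := u ⬝ᵥ (gramX *ᵥ v)

def tauIdx : Fin 22 → Fin 22 :=
  ![2,3,0,1,6,7,4,5,8,9,10,11,14,15,12,13,16,17,18,19,20,21]

def tauSign : Fin 22 → ℚ :=
  ![1,1,1,1,1,1,1,1,1,1,1,1,1,1,1,1,-1,-1,1,1,1,1]

def tau : V → V := fun u i => tauSign i * u (tauIdx i)

def phiIdx : Fin 22 → Fin 22 :=
  ![6,7,4,5,2,3,0,1,10,11,8,9,14,15,12,13,16,17,18,19,20,21]

def phi : V → V := fun u i => u (phiIdx i)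

def W : Set V := {u | ∀ i, ∃ n : ℤ, u i = (n : ℚ)}

/-- standard basis vectors -/
def bv : Fin 22 → V := fun i j => if i = j then 1 else 0

def vα : V := (1/3 : ℚ) •
  (-(bv 0) + bv 1 + bv 6 - bv 7 - bv 8 + bv 9 + bv 10 - bv 11 - bv 12 + bv 13 + bv 14 - bv 15)
def vβ : V := (1/3 : ℚ) •
  (-(bv 2) + bv 3 + bv 4 - bv 5 - bv 8 + bv 9 + bv 10 - bv 11 + bv 12 - bv 13 - bv 14 + bv 15)
def vγ : V := (1/3 : ℚ) • (bv 18 - bv 19 - bv 8 + bv 9 - bv 10 + bv 11)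
def vδ : V := (1/3 : ℚ) • (bv 18 - bv 4 + bv 5 - bv 6 + bv 7 - bv 8 + bv 9)
def vε : V := (1/3 : ℚ) •
  (bv 18 - bv 16 + bv 17 + bv 4 - bv 5 - bv 8 + bv 9 - bv 12 + bv 13 + bv 14 - bv 15)
def vζ : V := (1/2 : ℚ) •
  (bv 18 + bv 16 + bv 4 + bv 5 + bv 8 + bv 9 + bv 12 + bv 13 + bv 14 + bv 15 + vε)
  + (1/2 : ℚ) • bv 21
def vη : V := (1/2 : ℚ) • (bv 18 + bv 4 + bv 5 + bv 8 + bv 9 + vε)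
  + (1/6 : ℚ) • (bv 12 - bv 13 + bv 14 - bv 15) + (1/6 : ℚ) • bv 20 - (1/3 : ℚ) • bv 21

/-- The lattice Λ ≅ Λ_K3. -/
def Λ : Submodule ℤ V :=
  Submodule.span ℤ (Set.range bv ∪ {vα, vβ, vγ, vδ, vε, vζ, vη})

/-- The invariant lattice Λ^{τ,φ}. -/
def invSet : Set V := {u : V | u ∈ Λ ∧ tau u = u ∧ phi u = u}

/-- The fifteen generators of the co-invariant lattice Ω_{2,2}. -/
def ΩGens : Set V :=
  {bv 16, bv 17,
   bv 10 - bv 8, bv 11 - bv 9, bv 14 - bv 12, bv 15 - bv 13,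
   bv 2 - bv 0, bv 0 - bv 4, bv 4 - bv 6, bv 1 - bv 3, bv 5 - bv 1, bv 7 - bv 5,
   (1/3 : ℚ) • (bv 0 - bv 2 - bv 4 + bv 6 - bv 1 + bv 3 + bv 5 - bv 7 + bv 16 - bv 17),
   (1/3 : ℚ) • (-(bv 0) + bv 6 + bv 1 - bv 7 - bv 8 + bv 10 + bv 9 - bv 11
      - bv 12 + bv 14 + bv 13 - bv 15),
   (1/3 : ℚ) • (bv 0 + bv 2 - bv 4 - bv 6 - bv 1 - bv 3 + bv 5 + bv 7
      - bv 8 + bv 10 + bv 9 - bv 11)}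

lemma gramX_mulVec (w : V) : gramX *ᵥ w =
    ![-2 * w 0 + w 1, w 0 - 2 * w 1, -2 * w 2 + w 3, w 2 - 2 * w 3, -2 * w 4 + w 5, w 4 - 2 * w 5,
      -2 * w 6 + w 7, w 6 - 2 * w 7, -2 * w 8 + w 9, w 8 - 2 * w 9, -2 * w 10 + w 11,
      w 10 - 2 * w 11, -2 * w 12 + w 13, w 12 - 2 * w 13, -2 * w 14 + w 15, w 14 - 2 * w 15,
      -4 * w 16 + 2 * w 17, 2 * w 16 - 4 * w 17, 3 * w 19, 3 * w 18, 4 * w 20 + 2 * w 21,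
      2 * w 20 + 4 * w 21] := by
  funext i
  fin_cases i <;> simp [gramX, mulVec, dotProduct, Fin.sum_univ_succ] <;> ring

lemma B_eq_blocks (u w : V) : B u w =
    u 0 * (-2 * w 0 + w 1) + u 1 * (w 0 - 2 * w 1)
    + u 2 * (-2 * w 2 + w 3) + u 3 * (w 2 - 2 * w 3)
    + u 4 * (-2 * w 4 + w 5) + u 5 * (w 4 - 2 * w 5)
    + u 6 * (-2 * w 6 + w 7) + u 7 * (w 6 - 2 * w 7)
    + u 8 * (-2 * w 8 + w 9) + u 9 * (w 8 - 2 * w 9)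
    + u 10 * (-2 * w 10 + w 11) + u 11 * (w 10 - 2 * w 11)
    + u 12 * (-2 * w 12 + w 13) + u 13 * (w 12 - 2 * w 13)
    + u 14 * (-2 * w 14 + w 15) + u 15 * (w 14 - 2 * w 15)
    + u 16 * (-4 * w 16 + 2 * w 17) + u 17 * (2 * w 16 - 4 * w 17)
    + u 18 * (3 * w 19) + u 19 * (3 * w 18)
    + u 20 * (4 * w 20 + 2 * w 21) + u 21 * (2 * w 20 + 4 * w 21) := by
  rw [B, gramX_mulVec]
  simp [dotProduct, Fin.sum_univ_succ]
  ring

lemma sum_smul_bv (n : Fin 22 → ℤ) : ∑ i, n i • bv i = fun j => (n j : ℚ) := by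
  funext j
  simp [bv, Finset.sum_apply]

/-- Coordinates of an integral combination of the generators of `Λ`. -/
lemma exists_coords_of_mem_Λ {u : V} (hu : u ∈ Λ) :
    ∃ (n : Fin 22 → ℤ) (mα mβ mγ mδ mε mζ mη : ℤ), u = (
      ![n 0 - mα / 3, n 1 + mα / 3, n 2 - mβ / 3, n 3 + mβ / 3,
      n 4 + mβ / 3 - mδ / 3 + mε / 3 + 2 * mζ / 3 + 2 * mη / 3,
      n 5 - mβ / 3 + mδ / 3 - mε / 3 + mζ / 3 + mη / 3, n 6 + mα / 3 - mδ / 3,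
      n 7 - mα / 3 + mδ / 3, n 8 - mα / 3 - mβ / 3 - mγ / 3 - mδ / 3 - mε / 3 + mζ / 3 + mη / 3,
      n 9 + mα / 3 + mβ / 3 + mγ / 3 + mδ / 3 + mε / 3 + 2 * mζ / 3 + 2 * mη / 3,
      n 10 + mα / 3 + mβ / 3 - mγ / 3, n 11 - mα / 3 - mβ / 3 + mγ / 3,
      n 12 - mα / 3 + mβ / 3 - mε / 3 + mζ / 3, n 13 + mα / 3 - mβ / 3 + mε / 3 + 2 * mζ / 3,
      n 14 + mα / 3 - mβ / 3 + mε / 3 + 2 * mζ / 3 + mη / 3,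
      n 15 - mα / 3 + mβ / 3 - mε / 3 + mζ / 3 - mη / 3, n 16 - mε / 3 + mζ / 3 - mη / 6,
      n 17 + mε / 3 + mζ / 6 + mη / 6, n 18 + mγ / 3 + mδ / 3 + mε / 3 + 2 * mζ / 3 + 2 * mη / 3,
      n 19 - mγ / 3, n 20 + mη / 6, n 21 + mζ / 2 - mη / 3] : V) := by
  rw [Λ, Submodule.span_union, Submodule.mem_sup] at hu
  obtain ⟨a, ha, b, hb, rfl⟩ := hu
  obtain ⟨n, rfl⟩ := (Submodule.mem_span_range_iff_exists_fun ℤ).1 ha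
  simp only [Submodule.mem_span_insert, Submodule.mem_span_singleton] at hb
  obtain ⟨mα, _, ⟨mβ, _, ⟨mγ, _, ⟨mδ, _, ⟨mε, _, ⟨mζ, _, ⟨mη, rfl⟩, rfl⟩, rfl⟩, rfl⟩, rfl⟩,
    rfl⟩, rfl⟩ := hb
  refine ⟨n, mα, mβ, mγ, mδ, mε, mζ, mη, ?_⟩
  rw [sum_smul_bv]
  funext j
  fin_cases j <;> simp [vα, vβ, vγ, vδ, vε, vζ, vη, bv] <;> ring

lemma bv_mem_Λ (i : Fin 22) : bv i ∈ Λ :=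
  Submodule.subset_span (Or.inl ⟨i, rfl⟩)

/-- The coordinates of an element of the invariant lattice are constant on the
orbits of the basis vectors and vanish at `z` and `w`. -/
lemma coords_of_mem_invSet {w : V} (hw : w ∈ invSet) :
    (w 2 = w 0 ∧ w 4 = w 0 ∧ w 6 = w 0) ∧ (w 3 = w 1 ∧ w 5 = w 1 ∧ w 7 = w 1) ∧
    w 10 = w 8 ∧ w 11 = w 9 ∧ w 14 = w 12 ∧ w 15 = w 13 ∧ w 16 = 0 ∧ w 17 = 0 := by
  obtain ⟨-, ht, hp⟩ := hw
  have t (i : Fin 22) : tauSign i * w (tauIdx i) = w i := congrFun ht i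
  have p (i : Fin 22) : w (phiIdx i) = w i := congrFun hp i
  have t0 := t 0
  have t1 := t 1
  have t4 := t 4
  have t5 := t 5
  have t16 := t 16
  have t17 := t 17
  have p0 := p 0
  have p1 := p 1
  have p8 := p 8
  have p9 := p 9
  have p12 := p 12
  have p13 := p 13
  simp [tauSign, tauIdx] at t0 t1 t4 t5 t16 t17
  simp [phiIdx] at p0 p1 p8 p9 p12 p13
  refine ⟨⟨?_, ?_, ?_⟩, ⟨?_, ?_, ?_⟩, ?_, ?_, ?_, ?_, ?_, ?_⟩ <;> linarith

lemma bv_add_bv_add_bv_add_bv_mem_invSet :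
    bv 0 + bv 2 + bv 4 + bv 6 ∈ invSet ∧ bv 1 + bv 3 + bv 5 + bv 7 ∈ invSet := by
  have hm (i j k l : Fin 22) : bv i + bv j + bv k + bv l ∈ Λ :=
    add_mem (add_mem (add_mem (bv_mem_Λ i) (bv_mem_Λ j)) (bv_mem_Λ k)) (bv_mem_Λ l)
  constructor <;>
  · refine ⟨hm _ _ _ _, ?_, ?_⟩ <;> funext i <;> fin_cases i <;>
      simp [tau, phi, tauSign, tauIdx, phiIdx, bv]

lemma bv_add_bv_mem_invSet :
    bv 8 + bv 10 ∈ invSet ∧ bv 9 + bv 11 ∈ invSet ∧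
    bv 12 + bv 14 ∈ invSet ∧ bv 13 + bv 15 ∈ invSet := by
  refine ⟨?_, ?_, ?_, ?_⟩ <;>
  · refine ⟨add_mem (bv_mem_Λ _) (bv_mem_Λ _), ?_, ?_⟩ <;> funext i <;> fin_cases i <;>
      simp [tau, phi, tauSign, tauIdx, phiIdx, bv]

lemma bv_mem_invSet : bv 18 ∈ invSet ∧ bv 19 ∈ invSet ∧ bv 20 ∈ invSet ∧ bv 21 ∈ invSet := by
  refine ⟨?_, ?_, ?_, ?_⟩ <;>
  · refine ⟨bv_mem_Λ _, ?_, ?_⟩ <;> funext i <;> fin_cases i <;>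
      simp [tau, phi, tauSign, tauIdx, phiIdx, bv]

/-- Linear equations satisfied on the orthogonal complement of the invariant lattice. -/
lemma coords_of_orthogonal_invSet {u : V} (hu : ∀ w ∈ invSet, B u w = 0) :
    u 0 + u 2 + u 4 + u 6 = 0 ∧ u 1 + u 3 + u 5 + u 7 = 0 ∧
    u 8 + u 10 = 0 ∧ u 9 + u 11 = 0 ∧ u 12 + u 14 = 0 ∧ u 13 + u 15 = 0 ∧
    u 18 = 0 ∧ u 19 = 0 ∧ u 20 = 0 ∧ u 21 = 0 := by
  obtain ⟨h1, h2⟩ := bv_add_bv_add_bv_add_bv_mem_invSet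
  obtain ⟨h3, h4, h5, h6⟩ := bv_add_bv_mem_invSet
  obtain ⟨h7, h8, h9, h10⟩ := bv_mem_invSet
  replace h1 := hu _ h1
  replace h2 := hu _ h2
  replace h3 := hu _ h3
  replace h4 := hu _ h4
  replace h5 := hu _ h5
  replace h6 := hu _ h6
  replace h7 := hu _ h7
  replace h8 := hu _ h8
  replace h9 := hu _ h9
  replace h10 := hu _ h10
  simp [B_eq_blocks, bv] at h1 h2 h3 h4 h5 h6 h7 h8 h9 h10
  refine ⟨?_, ?_, ?_, ?_, ?_, ?_, ?_, ?_, ?_, ?_⟩ <;> linarith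

lemma ΩGens_subset_Λ : ΩGens ⊆ (Λ : Set V) := by
  have hs (i j : Fin 22) : bv i - bv j ∈ Λ := sub_mem (bv_mem_Λ i) (bv_mem_Λ j)
  have hα : vα ∈ Λ := Submodule.subset_span (by simp)
  have hβ : vβ ∈ Λ := Submodule.subset_span (by simp)
  have hδ : vδ ∈ Λ := Submodule.subset_span (by simp)
  have hε : vε ∈ Λ := Submodule.subset_span (by simp)
  rintro g (rfl | rfl | rfl | rfl | rfl | rfl | rfl | rfl | rfl | rfl | rfl | rfl | rfl | rfl | rfl)
  · exact bv_mem_Λ _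
  · exact bv_mem_Λ _
  iterate 10 exact hs _ _
  · have h := add_mem (add_mem (sub_mem (add_mem (sub_mem hβ hα) hδ) hε) (hs 6 7))
      (add_mem (hs 13 12) (hs 14 15))
    refine (congrArg (· ∈ Λ) ?_).mpr h
    simp only [vα, vβ, vδ, vε]
    module
  · refine (congrArg (· ∈ Λ) ?_).mpr hα
    simp only [vα]
    module
  · have h := add_mem (sub_mem (neg_mem hα) hβ) (add_mem (hs 9 8) (hs 10 11))
    refine (congrArg (· ∈ Λ) ?_).mpr h
    simp only [vα, vβ]
    module

lemma B_eq_zero_of_mem_ΩGens {g w : V} (hg : g ∈ ΩGens) (hw : w ∈ invSet) : B g w = 0 := by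
  obtain ⟨⟨h2, h4, h6⟩, ⟨h3, h5, h7⟩, h10, h11, h14, h15, h16, h17⟩ := coords_of_mem_invSet hw
  rw [B_eq_blocks, h2, h3, h4, h5, h6, h7, h10, h11, h14, h15, h16, h17]
  rcases hg with
    rfl | rfl | rfl | rfl | rfl | rfl | rfl | rfl | rfl | rfl | rfl | rfl | rfl | rfl | rfl <;>
  · simp [bv]
    try ring

lemma B_zero_left (w : V) : B 0 w = 0 := by simp [B]

lemma B_add_left (u v w : V) : B (u + v) w = B u w + B v w := by simp [B, add_dotProduct]

lemma B_zsmul_left (n : ℤ) (u w : V) : B (n • u) w = n * B u w := by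
  rw [B, smul_dotProduct, zsmul_eq_mul, B]

lemma vec_mem_span_ΩGens (c : Fin 12 → ℤ) : (
    ![c 4 + c 9 / 3 - c 10 / 3 + c 11 / 3, c 6 - c 7 - c 9 / 3 + c 10 / 3 - c 11 / 3,
      -c 9 / 3 + c 11 / 3, -c 6 + c 9 / 3 - c 11 / 3, -c 4 + c 5 - c 9 / 3 - c 11 / 3,
      c 7 - c 8 + c 9 / 3 + c 11 / 3, -c 5 + c 9 / 3 + c 10 / 3 - c 11 / 3,
      c 8 - c 9 / 3 - c 10 / 3 + c 11 / 3, -c 1 - c 10 / 3 - c 11 / 3, -c 2 + c 10 / 3 + c 11 / 3,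
      c 1 + c 10 / 3 + c 11 / 3, c 2 - c 10 / 3 - c 11 / 3, -c 10 / 3, -c 3 + c 10 / 3, c 10 / 3,
      c 3 - c 10 / 3, c 9 / 3, c 0 - c 9 / 3, 0, 0, 0, 0] : V)
      ∈ Submodule.span ℤ ΩGens := by
  have key : c 0 • bv 17 + c 1 • (bv 10 - bv 8) + c 2 • (bv 11 - bv 9) + c 3 • (bv 15 - bv 13)
      + c 4 • (bv 0 - bv 4) + c 5 • (bv 4 - bv 6) + c 6 • (bv 1 - bv 3) + c 7 • (bv 5 - bv 1)
      + c 8 • (bv 7 - bv 5)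
      + c 9 • ((1/3 : ℚ) •
        (bv 0 - bv 2 - bv 4 + bv 6 - bv 1 + bv 3 + bv 5 - bv 7 + bv 16 - bv 17))
      + c 10 • ((1/3 : ℚ) • (-(bv 0) + bv 6 + bv 1 - bv 7 - bv 8 + bv 10 + bv 9 - bv 11
        - bv 12 + bv 14 + bv 13 - bv 15))
      + c 11 • ((1/3 : ℚ) • (bv 0 + bv 2 - bv 4 - bv 6 - bv 1 - bv 3 + bv 5 + bv 7
        - bv 8 + bv 10 + bv 9 - bv 11)) ∈ Submodule.span ℤ ΩGens := by
    repeat' apply add_mem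
    all_goals exact Submodule.smul_mem _ _ (Submodule.subset_span (by simp [ΩGens]))
  refine (congrArg (· ∈ Submodule.span ℤ ΩGens) ?_).mpr key
  funext j
  fin_cases j <;> simp [bv] <;> ring

set_option maxHeartbeats 1600000 in
lemma mem_span_ΩGens_of_orthogonal {u : V} (hu : u ∈ Λ) (h : ∀ w ∈ invSet, B u w = 0) :
    u ∈ Submodule.span ℤ ΩGens := by
  obtain ⟨e0, e1, e8, e9, e12, e13, e18, e19, e20, e21⟩ := coords_of_orthogonal_invSet h
  obtain ⟨n, mα, mβ, mγ, mδ, mε, mζ, mη, rfl⟩ := exists_coords_of_mem_Λ hu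
  simp at e0 e1 e8 e9 e12 e13 e18 e19 e20 e21
  have key := vec_mem_span_ΩGens ![n 16 + n 17 - 2 * n 20 - n 21,
    -n 2 - n 8 + n 12 - n 16 - n 18 + 9 * n 20 + 2 * n 21 + mβ,
    n 2 - n 9 - n 12 + n 16 + n 18 + n 20 - mβ,
    -n 12 - n 13 + 4 * n 20 + 2 * n 21,
    n 0 - n 2 - n 12 - 2 * n 16 + 2 * n 20 + 2 * n 21 + mε,
    n 0 + n 4 - n 12 + n 18 + n 19 - 12 * n 20 - 2 * n 21 + mε,
    -n 2 - n 3,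
    -n 1 - 2 * n 2 - n 3 - n 12 - 2 * n 16 + 2 * n 20 + 2 * n 21 + mε,
    -n 1 - n 2 - n 3 - n 5 - n 12 + n 18 + n 19 - 2 * n 20 + mε,
    3 * n 16 - n 20 - 2 * n 21 - mε,
    -3 * n 12 + 4 * n 20 + 2 * n 21 + mα - mβ + mε,
    3 * n 2 + 3 * n 16 - n 20 - 2 * n 21 - mβ - mε]
  refine (congrArg (· ∈ Submodule.span ℤ ΩGens) ?_).mpr key
  funext j
  fin_cases j <;> simp <;> linarith

/-- the co-invariant lattice {u ∈ Λ : ⟨u,w⟩ = 0 ∀ w ∈ Λ^{τ,φ}}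
equals the ℤ-submodule Ω generated by the fifteen listed vectors. -/
theorem stmt3 :
    {u : V | u ∈ Λ ∧ ∀ w' ∈ invSet, B u w' = 0} =
      (Submodule.span ℤ ΩGens : Set V) := by
  ext u
  refine ⟨fun ⟨hu, h⟩ => mem_span_ΩGens_of_orthogonal hu h, fun hu => ⟨?_, fun w hw => ?_⟩⟩
  · exact Submodule.span_le.2 ΩGens_subset_Λ hu
  · induction hu using Submodule.span_induction with
    | mem g hg => exact B_eq_zero_of_mem_ΩGens hg hw
    | zero => exact B_zero_left w
    | add a b _ _ ha hb => rw [B_add_left, ha, hb, add_zero]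
    | smul c a _ ha => rw [B_zsmul_left, ha, mul_zero]
end
end

section
/- For all u,v ∈ V one has ⟨Q(u),Q(v)⟩~ = (1/2)·⟨u+φ(u), v+φ(v)⟩; moreover Q(W) = ℤ^14, the lattice spanned by the standard basis of V~. (This realizes the pushforward map π_{φ*} induced in cohomology by the rational quotient map X ⇢ Z̃_φ on the sublattice W of H²(X,ℤ): the image lattice is A_2 ⊕ A_2 ⊕ A_2 ⊕ A_2 ⊕ A_2(4) ⊕ U(6) ⊕ [[8,4],[4,8]].) -/
/- Context: V = ℚ^22 with the Gram matrix of the paper, W = ℤ^22, φ the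
involution; V~ = ℚ^14 (the target of π_{φ*}) with its Gram matrix, and
Q : V → V~ the pushforward map. -/

noncomputable section
open Matrix

/-- V~ = ℚ^14, coordinates (ã₁,ã₂,b̃₁,b̃₂,ẽ₁,ẽ₂,g̃₁,g̃₂,z̃,w̃,x̃,ỹ,ṽ₁,ṽ₂). -/
abbrev Vt : Type := Fin 14 → ℚ

/-- Gram matrix of V~: blocks [[-2,1],[1,-2]] on (0,1),(2,3),(4,5),(6,7);
[[-8,4],[4,-8]] on (8,9); [[0,6],[6,0]] on (10,11); [[8,4],[4,8]] on (12,13). -/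
def gramT : Matrix (Fin 14) (Fin 14) ℚ := Matrix.of fun i j =>
  if i = j then
    (if i.val < 8 then -2 else if i.val < 10 then -8 else if i.val < 12 then 0 else 8)
  else if i.val / 2 = j.val / 2 then
    (if i.val < 8 then 1 else if i.val < 10 then 4 else if i.val < 12 then 6 else 4)
  else 0

def Bt (u v : Vt) : ℚ := u ⬝ᵥ (gramT *ᵥ v)

/-- The pushforward π_{φ*} on W : a_i,d_i ↦ ã_i; b_i,c_i ↦ b̃_i; e_i,f_i ↦ ẽ_i;
g_i,h_i ↦ g̃_i; z ↦ z̃; w ↦ w̃; x ↦ x̃; y ↦ ỹ; v_i ↦ ṽ_i. -/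
def Q : V → Vt := fun u =>
  ![u 0 + u 6, u 1 + u 7, u 2 + u 4, u 3 + u 5, u 8 + u 10, u 9 + u 11,
    u 12 + u 14, u 13 + u 15, u 16, u 17, u 18, u 19, u 20, u 21]

set_option maxRecDepth 10000 in
/-- The form `B` written out block by block. -/
theorem B_eq (u v : V) : B u v =
      (-2 * (u 0 * v 0 + u 1 * v 1) + (u 0 * v 1 + u 1 * v 0)) +
      (-2 * (u 2 * v 2 + u 3 * v 3) + (u 2 * v 3 + u 3 * v 2)) +
      (-2 * (u 4 * v 4 + u 5 * v 5) + (u 4 * v 5 + u 5 * v 4)) +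
      (-2 * (u 6 * v 6 + u 7 * v 7) + (u 6 * v 7 + u 7 * v 6)) +
      (-2 * (u 8 * v 8 + u 9 * v 9) + (u 8 * v 9 + u 9 * v 8)) +
      (-2 * (u 10 * v 10 + u 11 * v 11) + (u 10 * v 11 + u 11 * v 10)) +
      (-2 * (u 12 * v 12 + u 13 * v 13) + (u 12 * v 13 + u 13 * v 12)) +
      (-2 * (u 14 * v 14 + u 15 * v 15) + (u 14 * v 15 + u 15 * v 14)) +
      (-4 * (u 16 * v 16 + u 17 * v 17) + 2 * (u 16 * v 17 + u 17 * v 16)) +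
      (3 * (u 18 * v 19 + u 19 * v 18)) +
      (4 * (u 20 * v 20 + u 21 * v 21) + 2 * (u 20 * v 21 + u 21 * v 20)) := by
  simp [B, gramX, dotProduct, mulVec, Fin.sum_univ_succ]
  ring

set_option maxRecDepth 10000 in
/-- The form `Bt` written out block by block. -/
theorem Bt_eq (u v : Vt) : Bt u v =
      (-2 * (u 0 * v 0 + u 1 * v 1) + (u 0 * v 1 + u 1 * v 0)) +
      (-2 * (u 2 * v 2 + u 3 * v 3) + (u 2 * v 3 + u 3 * v 2)) +
      (-2 * (u 4 * v 4 + u 5 * v 5) + (u 4 * v 5 + u 5 * v 4)) +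
      (-2 * (u 6 * v 6 + u 7 * v 7) + (u 6 * v 7 + u 7 * v 6)) +
      (-8 * (u 8 * v 8 + u 9 * v 9) + 4 * (u 8 * v 9 + u 9 * v 8)) +
      (6 * (u 10 * v 11 + u 11 * v 10)) +
      (8 * (u 12 * v 12 + u 13 * v 13) + 4 * (u 12 * v 13 + u 13 * v 12)) := by
  simp [Bt, gramT, dotProduct, mulVec, Fin.sum_univ_succ]
  ring

/-- the push-pull formula ⟨Q u, Q v⟩~ = ½⟨u+φu, v+φv⟩, and
Q(W) is the standard lattice ℤ^14 of V~. -/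
theorem stmt6 :
    (∀ u v : V, Bt (Q u) (Q v) = (1/2 : ℚ) * B (u + phi u) (v + phi v)) ∧
    Q '' W = {u : Vt | ∀ i, ∃ n : ℤ, u i = (n : ℚ)} := by
  constructor
  · intro u v
    rw [Bt_eq, B_eq]
    simp [Q, phi, phiIdx]
    ring
  · ext u
    constructor
    · rintro ⟨w, hw, rfl⟩ i
      choose n hn using hw
      fin_cases i <;> simp [Q, hn] <;> norm_cast <;> simp
    · intro hu
      refine ⟨![u 0, u 1, u 2, u 3, 0, 0, 0, 0, u 4, u 5, 0, 0, u 6, u 7, 0, 0,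
        u 8, u 9, u 10, u 11, u 12, u 13], ?_, ?_⟩
      · intro i
        fin_cases i <;> first | exact hu _ | exact ⟨0, by simp⟩
      · ext i
        fin_cases i <;> simp [Q]
end
end

section
/- The map τ^ is an involution preserving the bilinear form of V'' and mapping the standard lattice ℤ^22 onto itself, and for all u,v ∈ V'' one has ⟨R'(u),R'(v)⟩¯ = (1/2)·⟨u+τ^(u), v+τ^(v)⟩''. (This realizes the pushforward along the residual involution τ^ on Z̃_φ, whose action on the exceptional classes is n_1↔n_5, n_2↔n_4, n_3↔n_8, n_6↔n_7.) -/
/- Context: V'' = ℚ^22 = H²(Z̃_φ)-sublattice with coordinates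
(ã₁,ã₂,b̃₁,b̃₂,ẽ₁,ẽ₂,g̃₁,g̃₂,z̃,w̃,x̃,ỹ,ṽ₁,ṽ₂,n₁,…,n₈) (indices 0,…,21),
τ^ the residual involution, V¯ = ℚ^14 the target of the pushforward R'. -/

noncomputable section
open Matrix

abbrev V'' : Type := Fin 22 → ℚ

/-- Gram matrix of V'': [[-2,1],[1,-2]] on (0,1),(2,3),(4,5),(6,7);
[[-8,4],[4,-8]] on (8,9); [[0,6],[6,0]] on (10,11); [[8,4],[4,8]] on (12,13);
-2·Id on 14,…,21. -/
def gramPP : Matrix (Fin 22) (Fin 22) ℚ := Matrix.of fun i j =>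
  if 14 ≤ i.val ∨ 14 ≤ j.val then (if i = j then -2 else 0)
  else if i = j then
    (if i.val < 8 then -2 else if i.val < 10 then -8 else if i.val < 12 then 0 else 8)
  else if i.val / 2 = j.val / 2 then
    (if i.val < 8 then 1 else if i.val < 10 then 4 else if i.val < 12 then 6 else 4)
  else 0

def B'' (u v : V'') : ℚ := u ⬝ᵥ (gramPP *ᵥ v)

def tauHatIdx : Fin 22 → Fin 22 :=
  ![2,3,0,1,4,5,6,7,8,9,10,11,12,13,18,17,21,15,14,20,19,16]

def tauHatSign : Fin 22 → ℚ :=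
  ![1,1,1,1,1,1,1,1,-1,-1,1,1,1,1,1,1,1,1,1,1,1,1]

/-- τ^ : swaps ã_i↔b̃_i, sends z̃↦-z̃, w̃↦-w̃, swaps n₁↔n₅, n₂↔n₄, n₃↔n₈, n₆↔n₇;
fixes ẽ₁,ẽ₂,g̃₁,g̃₂,x̃,ỹ,ṽ₁,ṽ₂. -/
def tauHat : V'' → V'' := fun u i => tauHatSign i * u (tauHatIdx i)

def W'' : Set V'' := {u | ∀ i, ∃ n : ℤ, u i = (n : ℚ)}

/-- V¯ = ℚ^14 with coordinates (ā₁,ā₂,ē₁,ē₂,ḡ₁,ḡ₂,x̄,ȳ,v̄₁,v̄₂,ñ₁,…,ñ₄). -/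
abbrev Vb : Type := Fin 14 → ℚ

def gramB : Matrix (Fin 14) (Fin 14) ℚ := Matrix.of fun i j =>
  if 10 ≤ i.val ∨ 10 ≤ j.val then (if i = j then -2 else 0)
  else if i = j then
    (if i.val < 2 then -2 else if i.val < 6 then -4 else if i.val < 8 then 0 else 16)
  else if i.val / 2 = j.val / 2 then
    (if i.val < 2 then 1 else if i.val < 6 then 2 else if i.val < 8 then 12 else 8)
  else 0

def Bb (u v : Vb) : ℚ := u ⬝ᵥ (gramB *ᵥ v)

/-- The pushforward map R' = (π̂_τ)_* : ã_i,b̃_i ↦ ā_i; ẽ_i ↦ ē_i; g̃_i ↦ ḡ_i;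
z̃,w̃ ↦ 0; x̃ ↦ x̄; ỹ ↦ ȳ; ṽ_i ↦ v̄_i; n₁,n₅ ↦ ñ₁; n₂,n₄ ↦ ñ₂; n₃,n₈ ↦ ñ₃;
n₆,n₇ ↦ ñ₄. -/
def R' : V'' → Vb := fun u =>
  ![u 0 + u 2, u 1 + u 3, u 4, u 5, u 6, u 7, u 10, u 11, u 12, u 13,
    u 14 + u 18, u 15 + u 17, u 16 + u 21, u 19 + u 20]

theorem gramPP_mulVec (v : V'') : gramPP *ᵥ v =
    ![-2 * v 0 + v 1, v 0 - 2 * v 1, -2 * v 2 + v 3, v 2 - 2 * v 3,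
      -2 * v 4 + v 5, v 4 - 2 * v 5, -2 * v 6 + v 7, v 6 - 2 * v 7,
      -8 * v 8 + 4 * v 9, 4 * v 8 - 8 * v 9, 6 * v 11, 6 * v 10,
      8 * v 12 + 4 * v 13, 4 * v 12 + 8 * v 13,
      -2 * v 14, -2 * v 15, -2 * v 16, -2 * v 17, -2 * v 18, -2 * v 19, -2 * v 20, -2 * v 21] := by
  ext i
  fin_cases i <;> simp [gramPP, mulVec, dotProduct, Fin.sum_univ_succ] <;> ring

theorem gramB_mulVec (v : Vb) : gramB *ᵥ v =
    ![-2 * v 0 + v 1, v 0 - 2 * v 1, -4 * v 2 + 2 * v 3, 2 * v 2 - 4 * v 3,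
      -4 * v 4 + 2 * v 5, 2 * v 4 - 4 * v 5, 12 * v 7, 12 * v 6,
      16 * v 8 + 8 * v 9, 8 * v 8 + 16 * v 9, -2 * v 10, -2 * v 11, -2 * v 12, -2 * v 13] := by
  ext i
  fin_cases i <;> simp [gramB, mulVec, dotProduct, Fin.sum_univ_succ] <;> ring

theorem B''_apply (u v : V'') : B'' u v =
    -2 * (u 0 * v 0 + u 1 * v 1) + (u 0 * v 1 + u 1 * v 0) +
    (-2 * (u 2 * v 2 + u 3 * v 3) + (u 2 * v 3 + u 3 * v 2)) +
    (-2 * (u 4 * v 4 + u 5 * v 5) + (u 4 * v 5 + u 5 * v 4)) +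
    (-2 * (u 6 * v 6 + u 7 * v 7) + (u 6 * v 7 + u 7 * v 6)) +
    (-8 * (u 8 * v 8 + u 9 * v 9) + 4 * (u 8 * v 9 + u 9 * v 8)) +
    6 * (u 10 * v 11 + u 11 * v 10) +
    (8 * (u 12 * v 12 + u 13 * v 13) + 4 * (u 12 * v 13 + u 13 * v 12)) -
    2 * (u 14 * v 14 + u 15 * v 15 + u 16 * v 16 + u 17 * v 17 +
      u 18 * v 18 + u 19 * v 19 + u 20 * v 20 + u 21 * v 21) := by
  rw [B'', gramPP_mulVec]
  simp [dotProduct, Fin.sum_univ_succ]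
  ring

theorem Bb_apply (u v : Vb) : Bb u v =
    -2 * (u 0 * v 0 + u 1 * v 1) + (u 0 * v 1 + u 1 * v 0) +
    (-4 * (u 2 * v 2 + u 3 * v 3) + 2 * (u 2 * v 3 + u 3 * v 2)) +
    (-4 * (u 4 * v 4 + u 5 * v 5) + 2 * (u 4 * v 5 + u 5 * v 4)) +
    12 * (u 6 * v 7 + u 7 * v 6) +
    (16 * (u 8 * v 8 + u 9 * v 9) + 8 * (u 8 * v 9 + u 9 * v 8)) -
    2 * (u 10 * v 10 + u 11 * v 11 + u 12 * v 12 + u 13 * v 13) := by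
  rw [Bb, gramB_mulVec]
  simp [dotProduct, Fin.sum_univ_succ]
  ring

theorem tauHat_tauHat (u : V'') : tauHat (tauHat u) = u := by
  ext i
  fin_cases i <;> simp [tauHat, tauHatIdx, tauHatSign]

theorem tauHat_mem_W'' {u : V''} (hu : u ∈ W'') : tauHat u ∈ W'' := by
  intro i
  obtain ⟨n, hn⟩ := hu (tauHatIdx i)
  have hs : tauHatSign i = 1 ∨ tauHatSign i = -1 := by
    fin_cases i <;> simp [tauHatSign]
  rcases hs with hs | hs
  · exact ⟨n, by simp [tauHat, hs, hn]⟩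
  · exact ⟨-n, by simp [tauHat, hs, hn]⟩

/-- τ^ is an involutive isometry of V'' preserving ℤ^22, and the
push-pull formula ⟨R' u, R' v⟩¯ = ½⟨u+τ^u, v+τ^v⟩'' holds. -/
theorem stmt11 :
    tauHat ∘ tauHat = id ∧
    (∀ u v : V'', B'' (tauHat u) (tauHat v) = B'' u v) ∧
    tauHat '' W'' = W'' ∧
    (∀ u v : V'', Bb (R' u) (R' v) = (1/2 : ℚ) * B'' (u + tauHat u) (v + tauHat v)) := by
  refine ⟨funext tauHat_tauHat, fun u v => ?_, ?_, fun u v => ?_⟩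
  · simp only [B''_apply]
    simp [tauHat, tauHatIdx, tauHatSign]
    ring
  · exact Set.Subset.antisymm (Set.image_subset_iff.2 fun _ => tauHat_mem_W'')
      fun u hu => ⟨tauHat u, tauHat_mem_W'' hu, tauHat_tauHat u⟩
  · simp only [B''_apply, Bb_apply]
    simp [R', tauHat, tauHatIdx, tauHatSign]
    ring
end
end
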